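/- Let C > 0. There is no differentiable function f : [0,∞) → ℝ satisfying f'(s) = −√(C²·exp(−2·f(s)) + 1) for all s ≥ 0. -/

import Mathlib

/-- There is no differentiable `f : [0,∞) → ℝ` with
`f'(s) = -√(C²·exp(-2 f s) + 1)` for all `s ≥ 0`. -/
theorem stmt_1 (C : ℝ) (hC : 0 < C) :
    ¬ ∃ f : ℝ → ℝ, ∀ s ∈ Set.Ici (0:ℝ),
        HasDerivWithinAt f (-Real.sqrt (C ^ 2 * Real.exp (-(2 * f s)) + 1))
          (Set.Ici 0) s := by
  rintro ⟨f, hf⟩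
  -- The function `exp (f s) + C * s` is antitone, which forces `exp ∘ f` to become negative.
  have hderiv : ∀ s ∈ Set.Ici (0 : ℝ), HasDerivWithinAt (fun s => Real.exp (f s) + C * s)
      (Real.exp (f s) * -Real.sqrt (C ^ 2 * Real.exp (-(2 * f s)) + 1) + C * 1)
      (Set.Ici 0) s := fun s hs =>
    (hf s hs).exp.add ((hasDerivWithinAt_id s _).const_mul C)
  have hanti : AntitoneOn (fun s => Real.exp (f s) + C * s) (Set.Ici 0) := by
    refine antitoneOn_of_hasDerivWithinAt_nonpos (convex_Ici 0)
      (fun s hs => (hderiv s hs).continuousWithinAt)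
      (fun s hs => (hderiv s (interior_subset hs)).mono interior_subset) fun s _ => ?_
    have hsqrt : C * Real.exp (-f s) ≤ Real.sqrt (C ^ 2 * Real.exp (-(2 * f s)) + 1) := by
      apply Real.le_sqrt_of_sq_le
      rw [mul_pow, ← Real.exp_nat_mul]
      simp
    have hmul := mul_le_mul_of_nonneg_left hsqrt (Real.exp_pos (f s)).le
    have hexp : Real.exp (f s) * (C * Real.exp (-f s)) = C := by
      rw [mul_left_comm, ← Real.exp_add]
      simp
    linarith
  have hpos : 0 ≤ Real.exp (f 0) / C := by positivity
  have hle := hanti Set.self_mem_Ici hpos hpos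
  simp only [mul_div_cancel₀ _ hC.ne', mul_zero, add_zero] at hle
  linarith [Real.exp_pos (f (Real.exp (f 0) / C))]
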